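/- In a simple temporal graph (non-strict setting), every bi-path between two vertices uses a single common time label on all edges of its underlying path; i.e., all edges of the underlying path of a bi-path carry the same label, so the bi-path lies within a single snapshot. -/

import Mathlib

namespace TemporalPaper

/-- A temporal graph on vertex set `V`: an undirected labeling assigning to each
(unordered) pair of vertices a finite set of rational time labels; a pair is an
edge of the graph iff its label set is nonempty. -/
structure TemporalGraph (V : Type*) where
  label : V → V → Finset ℚ
  symm : ∀ u v, label u v = label v u
  loopless : ∀ v, label v v = ∅

namespace TemporalGraph

variable {V : Type*}

/-- The footprint (static underlying graph) of a temporal graph. -/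
def footprint (G : TemporalGraph V) : SimpleGraph V where
  Adj u v := (G.label u v).Nonempty
  symm := ⟨fun u v h => by change (G.label u v).Nonempty at h; change (G.label v u).Nonempty; rwa [G.symm]⟩
  loopless := ⟨fun v h => by change (G.label v v).Nonempty at h; rw [G.loopless] at h; exact Finset.not_nonempty_empty h⟩

/-- The snapshot of a temporal graph at time `t`. -/
def snapshot (G : TemporalGraph V) (t : ℚ) : SimpleGraph V where
  Adj u v := t ∈ G.label u v
  symm := ⟨fun u v h => by change t ∈ G.label u v at h; change t ∈ G.label v u; rwa [G.symm]⟩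
  loopless := ⟨fun v h => by change t ∈ G.label v v at h; rw [G.loopless] at h; exact absurd h (Finset.notMem_empty t)⟩

/-- `G.IsTJ r p ts` : the list of vertices `p` together with the list of times `ts`
(one per consecutive pair of vertices of `p`) forms a temporal walk, i.e. each time
belongs to the labels of the corresponding edge, and consecutive times satisfy `r`
(`r = (· ≤ ·)` for non-strict temporal walks, `r = (· < ·)` for strict ones). -/
inductive IsTJ (G : TemporalGraph V) (r : ℚ → ℚ → Prop) : List V → List ℚ → Prop
  | single (v : V) : IsTJ G r [v] []
  | cons {u v : V} {p : List V} {t : ℚ} {ts : List ℚ} :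
      t ∈ G.label u v → IsTJ G r (v :: p) ts →
      (∀ t' ∈ ts.head?, r t t') → IsTJ G r (u :: v :: p) (t :: ts)

/-- A temporal path from `u` to `v` with underlying (vertex-)path `p` and times `ts`. -/
def TPath (G : TemporalGraph V) (r : ℚ → ℚ → Prop) (u v : V)
    (p : List V) (ts : List ℚ) : Prop :=
  G.IsTJ r p ts ∧ p.Nodup ∧ p.head? = some u ∧ p.getLast? = some v

/-- Temporal reachability. -/
def Reach (G : TemporalGraph V) (r : ℚ → ℚ → Prop) (u v : V) : Prop :=
  ∃ p ts, G.TPath r u v p ts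

def TemporallyConnectedRel (G : TemporalGraph V) (r : ℚ → ℚ → Prop) : Prop :=
  ∀ u v : V, u ≠ v → G.Reach r u v

/-- Temporal connectivity (non-strict setting). -/
def TemporallyConnected (G : TemporalGraph V) : Prop :=
  G.TemporallyConnectedRel (· ≤ ·)

/-- A bidirectional temporal path (bi-path) between `u` and `v` on the underlying
path `p` (from `u` to `v`): a temporal path in each direction along `p`. -/
def BiPath (G : TemporalGraph V) (r : ℚ → ℚ → Prop) (u v : V)
    (p : List V) (ts₁ ts₂ : List ℚ) : Prop :=
  G.TPath r u v p ts₁ ∧ G.TPath r v u p.reverse ts₂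

def BiConnectedRel (G : TemporalGraph V) (r : ℚ → ℚ → Prop) : Prop :=
  ∀ u v : V, u ≠ v → ∃ p ts₁ ts₂, G.BiPath r u v p ts₁ ts₂

/-- Bidirectional temporal connectivity (non-strict setting). -/
def BiConnected (G : TemporalGraph V) : Prop := G.BiConnectedRel (· ≤ ·)

/-- `H` is a temporal subgraph of `G` (on the same vertex set). -/
def IsSubgraph (H G : TemporalGraph V) : Prop := ∀ u v, H.label u v ⊆ G.label u v

/-- A temporal spanner of `G`: a temporally connected temporal subgraph on all of `V`. -/
def IsSpanner (H G : TemporalGraph V) : Prop := H.IsSubgraph G ∧ H.TemporallyConnected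

/-- A temporal spanning tree of `G`: a temporal spanner whose footprint is a tree. -/
def IsSpanningTree (H G : TemporalGraph V) : Prop := H.IsSpanner G ∧ H.footprint.IsTree

/-- A bidirectional temporal spanner (bi-spanner) of `G`. -/
def IsBiSpanner (H G : TemporalGraph V) : Prop := H.IsSpanner G ∧ H.BiConnected

/-- A temporal graph is simple if every edge has exactly one time label,
i.e. every label set has at most one element (edges have nonempty label sets). -/
def Simple (G : TemporalGraph V) : Prop := ∀ u v, (G.label u v).card ≤ 1

/-- A temporal graph is proper if any two (distinct) edges sharing a vertex have
disjoint label sets. -/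
def Proper (G : TemporalGraph V) : Prop :=
  ∀ u v w : V, v ≠ w → Disjoint (G.label u v) (G.label u w)

def Happy (G : TemporalGraph V) : Prop := G.Simple ∧ G.Proper

/-- `u` can reach `v` by a (non-strict) temporal path arriving at time at most `t`. -/
def ArrivesBy (G : TemporalGraph V) (u v : V) (t : ℚ) : Prop :=
  ∃ p ts, G.TPath (· ≤ ·) u v p ts ∧ ∀ t' ∈ ts.getLast?, t' ≤ t

/-- `u` can reach `v` by a (non-strict) temporal path departing at time at least `t`. -/
def DepartsAfter (G : TemporalGraph V) (u v : V) (t : ℚ) : Prop :=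
  ∃ p ts, G.TPath (· ≤ ·) u v p ts ∧ ∀ t' ∈ ts.head?, t ≤ t'

/-- A pivot: some time `t` such that every other vertex reaches `x` by time `t`
and `x` reaches every other vertex departing not earlier than `t`. -/
def IsPivot (G : TemporalGraph V) (x : V) : Prop :=
  ∃ t : ℚ, ∀ u : V, u ≠ x → G.ArrivesBy u x t ∧ G.DepartsAfter x u t

/-- Deleting the (undirected) edge `ab` from a temporal graph. -/
def deleteEdge [DecidableEq V] (G : TemporalGraph V) (a b : V) : TemporalGraph V where
  label u v := if (u = a ∧ v = b) ∨ (u = b ∧ v = a) then ∅ else G.label u v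
  symm := by
    intro u v
    have h : ((u = a ∧ v = b) ∨ (u = b ∧ v = a)) ↔ ((v = a ∧ u = b) ∨ (v = b ∧ u = a)) := by
      tauto
    rw [G.symm, if_congr h rfl rfl]
  loopless := by
    intro v
    split_ifs with h
    · rfl
    · exact G.loopless v

end TemporalGraph

end TemporalPaper

namespace TemporalPaper

open TemporalGraph

namespace TemporalGraph

variable {V : Type*} {G : TemporalGraph V} {r : ℚ → ℚ → Prop} {p : List V} {ts : List ℚ}

theorem IsTJ.length_eq (h : G.IsTJ r p ts) : p.length = ts.length + 1 := by
  induction h with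
  | single v => simp
  | cons _ _ _ ih => simpa using ih

theorem IsTJ.isChain (h : G.IsTJ r p ts) : ts.IsChain r := by
  induction h with
  | single v => simp
  | cons _ _ hr ih => exact List.isChain_cons.2 ⟨hr, ih⟩

theorem IsTJ.getElem_mem_label (h : G.IsTJ r p ts) (i : ℕ) (hi : i < ts.length)
    (hp : i + 1 < p.length) : ts[i] ∈ G.label p[i] p[i + 1] := by
  induction h generalizing i with
  | single v => simp at hi
  | cons ht _ _ ih =>
    cases i with
    | zero => simpa using ht
    | succ i => exact ih i (by simpa using hi) (by simpa using hp)

theorem Simple.eq_of_mem_label (hs : G.Simple) {a b : V} {s t : ℚ} (h : s ∈ G.label a b)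
    (h' : t ∈ G.label a b) : s = t :=
  Finset.card_le_one.1 (hs a b) s h t h'

/-- In a simple temporal graph, the times of a temporal walk are determined by its
vertices, up to reversal. -/
theorem Simple.eq_reverse (hs : G.Simple) {r' : ℚ → ℚ → Prop} {ts' : List ℚ}
    (h : G.IsTJ r p ts) (h' : G.IsTJ r' p.reverse ts') : ts' = ts.reverse := by
  have hl := h.length_eq
  have hl' := h'.length_eq
  rw [List.length_reverse] at hl'
  refine List.ext_getElem (by simp; omega) fun i hi hi' => ?_
  rw [List.length_reverse] at hi'
  have h1 := h'.getElem_mem_label i hi (by simp; omega)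
  have h2 := h.getElem_mem_label (ts.length - 1 - i) (by omega) (by omega)
  rw [List.getElem_reverse, List.getElem_reverse, G.symm] at h1
  rw [List.getElem_reverse]
  refine hs.eq_of_mem_label h1 ?_
  convert h2 using 3
  · omega
  · omega

end TemporalGraph

/-- in a simple temporal graph (non-strict setting), every bi-path uses a
single common time label `t` on all edges of its underlying path: all times of both
directions equal `t`, so all edges of the underlying path belong to the snapshot at
time `t`, and the bi-path lies within a single snapshot. -/
theorem stmt7 {V : Type*} [Fintype V] (G : TemporalGraph V) (hs : G.Simple)
    {u v : V} {p : List V} {ts₁ ts₂ : List ℚ}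
    (h : G.BiPath (· ≤ ·) u v p ts₁ ts₂) :
    ∃ t : ℚ, (∀ s ∈ ts₁, s = t) ∧ (∀ s ∈ ts₂, s = t) ∧
      ∀ a b : V, [a, b] <:+: p → (G.snapshot t).Adj a b := by
  obtain ⟨⟨h₁, -⟩, ⟨h₂, -⟩⟩ := h
  obtain rfl := hs.eq_reverse h₁ h₂
  have hle : ts₁.Pairwise (· ≤ ·) := h₁.isChain.pairwise
  have hge : ts₁.Pairwise (fun a b => b ≤ a) := List.pairwise_reverse.1 h₂.isChain.pairwise
  have hconst : ∃ t : ℚ, ∀ s ∈ ts₁, s = t := by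
    cases ts₁ with
    | nil => exact ⟨0, by simp⟩
    | cons t ts =>
      refine ⟨t, fun s hmem => ?_⟩
      rcases List.mem_cons.1 hmem with rfl | hmem
      · rfl
      · exact le_antisymm (List.rel_of_pairwise_cons hge hmem)
          (List.rel_of_pairwise_cons hle hmem)
  obtain ⟨t, ht⟩ := hconst
  refine ⟨t, ht, fun s hmem => ht s (List.mem_reverse.1 hmem), ?_⟩
  rintro a b ⟨l, l', rfl⟩
  have hl := h₁.length_eq
  simp only [List.length_append, List.length_cons, List.length_nil] at hl
  have hlt : l.length < ts₁.length := by omega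
  have hmem := h₁.getElem_mem_label l.length hlt (by simp)
  rw [ht _ (List.getElem_mem hlt)] at hmem
  change t ∈ G.label a b
  simpa using hmem

end TemporalPaper
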